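/- For any cyclic sequence (i_1,...,i_m) in {1,...,q} with cyclically adjacent entries distinct whose kernel partition π is noncrossing, the Cayley length of σ = (i_1,i_2)(i_2,i_3)···(i_m,i_1) is |σ| = m − 2|K(π)|, where |K(π)| = m + 1 − |π|; equivalently |σ| = 2|π| − m − 2. -/

import Mathlib

open Finset

/-- `x` and `y` lie in the same block of the partition `π`. -/
def SameBlock {α : Type*} [DecidableEq α] {s : Finset α} (π : Finpartition s)
    (x y : α) : Prop :=
  ∃ B ∈ π.parts, x ∈ B ∧ y ∈ B

/-- A partition of `{1,…,n}` (modelled on `Fin n`) is noncrossing if whenever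
`a < b < c < d` with `a,c` in one block and `b,d` in one block, all four lie in a
common block. -/
def Noncrossing {n : ℕ} (π : Finpartition (univ : Finset (Fin n))) : Prop :=
  ∀ a b c d : Fin n, a < b → b < c → c < d →
    SameBlock π a c → SameBlock π b d → SameBlock π a b

/-- The position of a point in the interleaved sequence `1,1',2,2',…,n,n'`:
`(i, false)` is the point `i+1` and `(i, true)` is the primed point `(i+1)'`. -/
def interPos {n : ℕ} (x : Fin n × Bool) : ℕ :=
  2 * x.1.val + (if x.2 then 1 else 0)

/-- Same-block relation for the union of a partition `π` of the unprimed points with a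
partition `κ` of the primed points. -/
def UnionRel {n : ℕ} (π κ : Finpartition (univ : Finset (Fin n)))
    (x y : Fin n × Bool) : Prop :=
  x.2 = y.2 ∧ (if x.2 = true then SameBlock κ x.1 y.1 else SameBlock π x.1 y.1)

/-- `π ∪ κ` is a noncrossing partition of the interleaved points `1,1',2,2',…,n,n'`. -/
def UnionNoncrossing {n : ℕ} (π κ : Finpartition (univ : Finset (Fin n))) : Prop :=
  ∀ a b c d : Fin n × Bool,
    interPos a < interPos b → interPos b < interPos c → interPos c < interPos d →
    UnionRel π κ a c → UnionRel π κ b d → UnionRel π κ a b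

/-- `κ` is the Kreweras complement of `π`: it is the maximal partition of the primed
points `1',…,n'` such that `π ∪ κ` is noncrossing on the interleaved points. -/
def IsKreweras {n : ℕ} (π κ : Finpartition (univ : Finset (Fin n))) : Prop :=
  UnionNoncrossing π κ ∧
    ∀ κ' : Finpartition (univ : Finset (Fin n)), UnionNoncrossing π κ' → κ' ≤ κ

/-- The Cayley length of a permutation: the minimal number of transpositions needed to
express it as a product. -/
noncomputable def cayleyLength {α : Type*} [DecidableEq α] (σ : Equiv.Perm α) : ℕ :=
  sInf {l | ∃ L : List (Equiv.Perm α), L.length = l ∧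
    (∀ τ ∈ L, ∃ a b, a ≠ b ∧ τ = Equiv.swap a b) ∧ L.prod = σ}

/-- The kernel partition of a sequence `i : Fin m → Fin q`: positions `j, l` are in the
same block iff `i j = i l`. -/
def kernelPartition {m q : ℕ} (i : Fin m → Fin q) :
    Finpartition (univ : Finset (Fin m)) :=
  @Finpartition.ofSetoid (Fin m) _ _ (Setoid.ker i)
    (fun a b => inferInstanceAs (Decidable (i a = i b)))

/-- The cyclic product of transpositions `(i₁ i₂)(i₂ i₃)⋯(i_{m-1} i_m)(i_m i₁)`
associated with the sequence `i`. -/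
def cyclicProd {m q : ℕ} (i : Fin m → Fin q) : Equiv.Perm (Fin q) :=
  ((List.finRange m).map fun j => Equiv.swap (i j) (i (finRotate m j))).prod


section Cayley
variable {α : Type*} [DecidableEq α]

lemma cl_le {σ : Equiv.Perm α} (L : List (Equiv.Perm α))
    (h : ∀ τ ∈ L, ∃ a b, a ≠ b ∧ τ = Equiv.swap a b) (hp : L.prod = σ) :
    cayleyLength σ ≤ L.length :=
  Nat.sInf_le ⟨L, rfl, h, hp⟩

lemma cl_spec [Finite α] (σ : Equiv.Perm α) :
    ∃ L : List (Equiv.Perm α), L.length = cayleyLength σ ∧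
    (∀ τ ∈ L, ∃ a b, a ≠ b ∧ τ = Equiv.swap a b) ∧ L.prod = σ := by
  have hne : {l | ∃ L : List (Equiv.Perm α), L.length = l ∧
    (∀ τ ∈ L, ∃ a b, a ≠ b ∧ τ = Equiv.swap a b) ∧ L.prod = σ}.Nonempty := by
    induction σ using Equiv.Perm.swap_induction_on with
    | one => exact ⟨0, [], by simp⟩
    | swap_mul f x y hxy ih =>
      obtain ⟨l, L, h1, h2, h3⟩ := ih
      refine ⟨l + 1, Equiv.swap x y :: L, by simp [h1], ?_, by simp [h3]⟩
      intro τ hτ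
      rcases List.mem_cons.1 hτ with rfl | h
      · exact ⟨x, y, hxy, rfl⟩
      · exact h2 τ h
  exact Nat.sInf_mem hne

lemma cl_one : cayleyLength (1 : Equiv.Perm α) = 0 :=
  Nat.le_zero.1 (cl_le [] (by simp) (by simp))

lemma swap_norm (x : α) (L : List (Equiv.Perm α))
    (h : ∀ τ ∈ L, ∃ a b, a ≠ b ∧ τ = Equiv.swap a b) :
    ∃ (L' : List (Equiv.Perm α)) (b : α),
      (∀ τ ∈ L', ∃ a c, a ≠ c ∧ a ≠ x ∧ c ≠ x ∧ τ = Equiv.swap a c) ∧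
      L.prod = L'.prod * Equiv.swap x b ∧
      L'.length + (if b = x then 0 else 1) ≤ L.length := by
  have key : ∀ L' : List (Equiv.Perm α),
      (∀ τ ∈ L', ∃ a c, a ≠ c ∧ a ≠ x ∧ c ≠ x ∧ τ = Equiv.swap a c) → L'.prod x = x := by
    intro L' hL'
    induction L' with
    | nil => simp
    | cons t L' ih =>
      obtain ⟨a, c, hac, ha, hc, rfl⟩ := hL' t (by simp)
      rw [List.prod_cons, Equiv.Perm.mul_apply, ih (fun τ hτ => hL' τ (by simp [hτ]))]
      exact Equiv.swap_apply_of_ne_of_ne ha.symm hc.symm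
  -- handling of a transposition (x c)
  have main : ∀ (L' : List (Equiv.Perm α)) (b c : α) (n : ℕ), c ≠ x →
      (∀ τ ∈ L', ∃ a c, a ≠ c ∧ a ≠ x ∧ c ≠ x ∧ τ = Equiv.swap a c) →
      L'.length + (if b = x then 0 else 1) ≤ n →
      ∃ (L'' : List (Equiv.Perm α)) (b' : α),
      (∀ τ ∈ L'', ∃ a c, a ≠ c ∧ a ≠ x ∧ c ≠ x ∧ τ = Equiv.swap a c) ∧
      Equiv.swap x c * (L'.prod * Equiv.swap x b) = L''.prod * Equiv.swap x b' ∧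
      L''.length + (if b' = x then 0 else 1) ≤ n + 1 := by
    intro L' b c n hc hL' hn
    have hfix := key L' hL'
    obtain ⟨d, hd⟩ : ∃ d, L'.prod d = c := L'.prod.surjective c
    have hdx : d ≠ x := by rintro rfl; exact hc (hd.symm.trans hfix)
    have hconj : Equiv.swap x c * L'.prod = L'.prod * Equiv.swap x d := by
      rw [Equiv.mul_swap_eq_swap_mul, hfix, hd]
    by_cases hbx : b = x
    · subst hbx
      refine ⟨L', d, hL', ?_, ?_⟩
      · rw [← mul_assoc, hconj]; simp [← Equiv.Perm.one_def]
      · simp [hdx] at hn ⊢; omega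
    by_cases hbd : b = d
    · subst hbd
      refine ⟨L', x, hL', ?_, ?_⟩
      · rw [← mul_assoc, hconj]; simp [← Equiv.Perm.one_def]
      · simp [hbx] at hn ⊢; omega
    · refine ⟨L' ++ [Equiv.swap d b], d, ?_, ?_, ?_⟩
      · intro τ hτ
        rcases List.mem_append.1 hτ with h | h
        · exact hL' τ h
        · exact ⟨d, b, Ne.symm hbd, hdx, hbx, by simpa using h⟩
      · rw [← mul_assoc, hconj, mul_assoc, List.prod_append, List.prod_singleton, mul_assoc]
        congr 1
        rw [Equiv.mul_swap_eq_swap_mul (Equiv.swap x d), Equiv.swap_apply_left,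
          Equiv.swap_apply_of_ne_of_ne hbx hbd]
      · simp [hbx, hdx] at hn ⊢; omega
  induction L with
  | nil => exact ⟨[], x, by simp [← Equiv.Perm.one_def]⟩
  | cons t L ih =>
    obtain ⟨L', b, h1, h2, h3⟩ := ih (fun τ hτ => h τ (by simp [hτ]))
    obtain ⟨a, c, hac, rfl⟩ := h t (by simp)
    rw [List.prod_cons, h2, List.length_cons]
    by_cases hax : a = x
    · subst hax
      exact main L' b c _ (Ne.symm hac) h1 h3
    by_cases hcx : c = x
    · subst hcx
      rw [Equiv.swap_comm]
      exact main L' b a _ hac h1 h3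
    · refine ⟨Equiv.swap a c :: L', b, ?_, by simp [mul_assoc], by simp; omega⟩
      intro τ hτ
      rcases List.mem_cons.1 hτ with rfl | h
      · exact ⟨a, c, hac, hax, hcx, rfl⟩
      · exact h1 τ h

lemma cl_mul_swap [Finite α] (σ : Equiv.Perm α) (x y : α) (hx : σ x = x) (hxy : y ≠ x) :
    cayleyLength (σ * Equiv.swap x y) = cayleyLength σ + 1 := by
  apply le_antisymm
  · obtain ⟨L, h1, h2, h3⟩ := cl_spec σ
    have := cl_le (σ := σ * Equiv.swap x y) (L ++ [Equiv.swap x y]) (by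
      intro τ hτ
      rcases List.mem_append.1 hτ with h | h
      · exact h2 τ h
      · exact ⟨x, y, Ne.symm hxy, by simpa using h⟩) (by simp [h3])
    simpa [h1] using this
  · obtain ⟨L, h1, h2, h3⟩ := cl_spec (σ * Equiv.swap x y)
    obtain ⟨L', b, g1, g2, g3⟩ := swap_norm x L h2
    have hfix : L'.prod x = x := by
      clear g2 g3
      induction L' with
      | nil => simp
      | cons t L' ih =>
        obtain ⟨a, c, hac, ha, hc, rfl⟩ := g1 t (by simp)
        rw [List.prod_cons, Equiv.Perm.mul_apply, ih (fun τ hτ => g1 τ (by simp [hτ]))]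
        exact Equiv.swap_apply_of_ne_of_ne ha.symm hc.symm
    rw [h3] at g2
    have hyb : y = b := by
      have e := congrArg (fun f : Equiv.Perm α => f y) g2
      simp only [Equiv.Perm.mul_apply, Equiv.swap_apply_right, hx] at e
      have e2 : Equiv.swap x b y = x := L'.prod.injective (e.symm.trans hfix.symm)
      have := congrArg (Equiv.swap x b) e2
      simpa using this
    subst hyb
    have hs : σ = L'.prod := mul_right_cancel g2
    have := cl_le (σ := σ) L' (fun τ hτ => by
      obtain ⟨a, c, h, _, _, e⟩ := g1 τ hτ
      exact ⟨a, c, h, e⟩) hs.symm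
    simp [hxy] at g3
    omega

def pathProd (L : List α) : Equiv.Perm α := (List.zipWith Equiv.swap L L.tail).prod

lemma pathProd_single (a : α) : pathProd [a] = 1 := by simp [pathProd]

lemma pathProd_cons (a b : α) (L : List α) :
    pathProd (a :: b :: L) = Equiv.swap a b * pathProd (b :: L) := by simp [pathProd]

lemma pathProd_append (U : List α) (a : α) (V : List α) :
    pathProd (U ++ a :: V) = pathProd (U ++ [a]) * pathProd (a :: V) := by
  induction U with
  | nil => simp [pathProd_single]
  | cons c U ih =>
    cases U with
    | nil => simp [pathProd_cons, pathProd_single]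
    | cons d U => simp only [List.cons_append, pathProd_cons] at ih ⊢; rw [ih, mul_assoc]

lemma pathProd_fix (L : List α) (x : α) (hx : x ∉ L) : pathProd L x = x := by
  induction L with
  | nil => simp [pathProd]
  | cons c U ih =>
    cases U with
    | nil => simp [pathProd_single]
    | cons d U =>
      rw [pathProd_cons, Equiv.Perm.mul_apply, ih (by simp_all)]
      simp only [List.mem_cons, not_or] at hx
      exact Equiv.swap_apply_of_ne_of_ne hx.1 hx.2.1

lemma exists_min_dup (L : List α) (h : ¬ L.Nodup) :
    ∃ U a M V, L = U ++ a :: (M ++ a :: V) ∧ (a :: M).Nodup := by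
  induction L with
  | nil => simp at h
  | cons c t ih =>
    by_cases ht : t.Nodup
    · have hc : c ∈ t := by
        by_contra hc
        exact h (List.nodup_cons.2 ⟨hc, ht⟩)
      obtain ⟨M, V, rfl, hM⟩ := List.eq_append_cons_of_mem hc
      exact ⟨[], c, M, V, rfl, List.nodup_cons.2 ⟨hM, (List.nodup_append.1 ht).1⟩⟩
    · obtain ⟨U, a, M, V, rfl, h2⟩ := ih ht
      exact ⟨c :: U, a, M, V, rfl, h2⟩

def NCList (L : List α) : Prop := ∀ a b, a ≠ b → ¬ List.Sublist [a, b, a, b] L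

lemma exists_singleton (L : List α) (h : ¬ L.Nodup) (hc : L.IsChain (· ≠ ·)) (hn : NCList L) :
    ∃ U a x b V, L = U ++ a :: x :: b :: V ∧ x ∉ U ∧ x ∉ V ∧ x ≠ a ∧ x ≠ b := by
  obtain ⟨U, a, M, V, rfl, h2⟩ := exists_min_dup L h
  cases M with
  | nil =>
    exfalso
    simp [List.isChain_append] at hc
  | cons x M =>
    have hxa : x ≠ a := by rintro rfl; simp at h2
    have hxM : x ∉ M := by simp at h2; exact h2.2.1
    have s1 : List.Sublist [a, x, a] (a :: (x :: M ++ a :: V)) := by simp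
    have hxU : x ∉ U := by
      intro hx
      apply hn x a hxa
      exact (List.singleton_sublist.2 hx).append s1
    have hxV : x ∉ V := by
      intro hx
      apply hn a x hxa.symm
      refine List.Sublist.trans ?_ (List.sublist_append_right _ _)
      simp [hx]
    cases M with
    | nil => exact ⟨U, a, x, a, V, rfl, hxU, hxV, hxa, hxa⟩
    | cons b M =>
      simp at hxM
      exact ⟨U, a, x, b, M ++ a :: V, by simp, hxU, by simp [hxM, hxV, hxa], hxa, hxM.1⟩

lemma cl_path [Finite α] (N : ℕ) : ∀ L : List α, L.length = N → L ≠ [] → L.head? = L.getLast? →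
    L.IsChain (· ≠ ·) → NCList L →
    (cayleyLength (pathProd L) : ℤ) = 2 * L.toFinset.card - L.length - 1 := by
  induction N using Nat.strong_induction_on with
  | _ N ih =>
  intro L hL hne hcl hc hn
  by_cases hnd : L.Nodup
  · obtain ⟨a, t, rfl⟩ := List.exists_cons_of_ne_nil hne
    rcases List.eq_nil_or_concat t with rfl | ⟨s, b, rfl⟩
    · simp [pathProd_single, cl_one]
    · exfalso
      rw [List.concat_eq_append, ← List.cons_append, List.getLast?_concat] at hcl
      simp at hcl
      subst hcl
      simp at hnd
  · obtain ⟨U, a, x, b, V, rfl, hU, hV, hxa, hxb⟩ := exists_singleton L hnd hc hn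
    have hP : pathProd (U ++ a :: x :: b :: V) =
        pathProd (U ++ [a]) * (Equiv.swap a x * Equiv.swap x b) * pathProd (b :: V) := by
      rw [pathProd_append, pathProd_cons, pathProd_cons]; simp only [mul_assoc]
    by_cases hab : a = b
    · subst hab
      have h1 := ih (U ++ a :: V).length (by rw [← hL]; simp) (U ++ a :: V) rfl (by simp)
        (by
          simp only [List.getLast?_append, List.getLast?_cons_cons] at hcl ⊢
          rw [← hcl]; cases U <;> simp)
        (by
          simp only [List.isChain_append, List.isChain_cons_cons] at hc ⊢
          refine ⟨hc.1, hc.2.1.2.2, by simpa using hc.2.2⟩)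
        (fun c d hcd hs => hn c d hcd (hs.trans (by simp)))
      have e : pathProd (U ++ a :: x :: a :: V) = pathProd (U ++ a :: V) := by
        rw [hP, Equiv.swap_comm x a, Equiv.swap_mul_self, mul_one, ← pathProd_append]
      have hT : (U ++ a :: x :: a :: V).toFinset = insert x (U ++ a :: V).toFinset := by
        ext z; simp only [List.mem_toFinset, List.mem_append, List.mem_cons, Finset.mem_insert]; tauto
      rw [e, h1, hT, Finset.card_insert_of_notMem (by simp [hU, hV, hxa])]
      simp only [List.length_append, List.length_cons]; push_cast; ring
    · have h1 := ih (U ++ a :: b :: V).length (by rw [← hL]; simp) (U ++ a :: b :: V) rfl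
        (by simp)
        (by
          simp only [List.getLast?_append, List.getLast?_cons_cons] at hcl ⊢
          rw [← hcl]; cases U <;> simp)
        (by
          simp only [List.isChain_append, List.isChain_cons_cons] at hc ⊢
          refine ⟨hc.1, ⟨hab, hc.2.1.2.2⟩, by simpa using hc.2.2⟩)
        (fun c d hcd hs => hn c d hcd (hs.trans (by simp)))
      set w := pathProd (b :: V) with hw
      have hwx : w x = x := pathProd_fix _ _ (by simp [hV, hxb])
      obtain ⟨y, hy⟩ := w.surjective a
      have hyx : y ≠ x := by rintro rfl; exact hxa (hwx.symm.trans hy)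
      have e : pathProd (U ++ a :: x :: b :: V) =
          pathProd (U ++ a :: b :: V) * Equiv.swap x y := by
        rw [hP, pathProd_append U a (b :: V), pathProd_cons, ← hw]
        simp only [mul_assoc]
        congr 1
        rw [Equiv.mul_swap_eq_swap_mul w, hwx, hy, ← mul_assoc, ← mul_assoc]
        congr 1
        rw [Equiv.mul_swap_eq_swap_mul (Equiv.swap a x), Equiv.swap_apply_right,
          Equiv.swap_apply_of_ne_of_ne (Ne.symm hab) (Ne.symm hxb), Equiv.swap_comm x a]
      have hT : (U ++ a :: x :: b :: V).toFinset = insert x (U ++ a :: b :: V).toFinset := by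
        ext z; simp; tauto
      rw [e, cl_mul_swap _ _ _ (pathProd_fix _ _ (by simp [hU, hV, hxa, hxb])) hyx, hT,
        Finset.card_insert_of_notMem (by simp [hU, hV, hxa, hxb])]
      push_cast
      rw [h1]
      simp only [List.length_append, List.length_cons]; push_cast; ring

end Cayley

section Kreweras

lemma sameBlock_iff {m : ℕ} (P : Finpartition (univ : Finset (Fin m))) (x y : Fin m) :
    SameBlock P x y ↔ P.part x = P.part y := by
  constructor
  · rintro ⟨B, hB, hx, hy⟩
    rw [P.part_eq_of_mem hB hx, P.part_eq_of_mem hB hy]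
  · intro h
    exact ⟨P.part x, P.part_mem.2 (mem_univ _), P.mem_part (mem_univ _),
      h ▸ P.mem_part (mem_univ _)⟩

lemma sameBlock_ofSetoid {m : ℕ} (s : Setoid (Fin m)) [DecidableRel s.r] (x y : Fin m) :
    SameBlock (Finpartition.ofSetoid s) x y ↔ s x y := by
  rw [← Finpartition.mem_part_ofSetoid_iff_rel, Finpartition.mem_part_iff_exists]
  unfold SameBlock
  constructor
  · rintro ⟨B, hB, hx, hy⟩; exact ⟨B, hB, hy, hx⟩
  · rintro ⟨B, hB, hx, hy⟩; exact ⟨B, hB, hy, hx⟩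

lemma sameBlock_kernel {m q : ℕ} (i : Fin m → Fin q) (x y : Fin m) :
    SameBlock (kernelPartition i) x y ↔ i x = i y := by
  unfold kernelPartition
  rw [sameBlock_ofSetoid]
  rfl

open Classical in
lemma card_parts_max {m : ℕ} (P : Finpartition (univ : Finset (Fin m))) :
    P.parts.card = (univ.filter fun j : Fin m => ∀ l, SameBlock P j l → l ≤ j).card := by
  symm
  apply Finset.card_bij (fun j _ => P.part j)
  · intro j _; exact P.part_mem.2 (mem_univ _)
  · intro a ha b hb hab
    simp only [mem_filter, mem_univ, true_and] at ha hb
    exact le_antisymm (hb a ((sameBlock_iff P _ _).2 hab.symm)) (ha b ((sameBlock_iff P _ _).2 hab))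
  · intro B hB
    have hne := P.nonempty_of_mem_parts hB
    refine ⟨B.max' hne, ?_, P.part_eq_of_mem hB (B.max'_mem hne)⟩
    simp only [mem_filter, mem_univ, true_and]
    intro l hl
    rw [sameBlock_iff, P.part_eq_of_mem hB (B.max'_mem hne)] at hl
    exact B.le_max' l (hl ▸ P.mem_part (mem_univ l))

open Classical in
lemma card_parts_min {m : ℕ} (P : Finpartition (univ : Finset (Fin m))) :
    P.parts.card = (univ.filter fun j : Fin m => ∀ l, SameBlock P j l → j ≤ l).card := by
  symm
  apply Finset.card_bij (fun j _ => P.part j)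
  · intro j _; exact P.part_mem.2 (mem_univ _)
  · intro a ha b hb hab
    simp only [mem_filter, mem_univ, true_and] at ha hb
    exact le_antisymm (ha b ((sameBlock_iff P _ _).2 hab)) (hb a ((sameBlock_iff P _ _).2 hab.symm))
  · intro B hB
    have hne := P.nonempty_of_mem_parts hB
    refine ⟨B.min' hne, ?_, P.part_eq_of_mem hB (B.min'_mem hne)⟩
    simp only [mem_filter, mem_univ, true_and]
    intro l hl
    rw [sameBlock_iff, P.part_eq_of_mem hB (B.min'_mem hne)] at hl
    exact B.min'_le l (hl ▸ P.mem_part (mem_univ l))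

/-- `j` and `l` are not separated by any block of the kernel of `i`. -/
def krewSetoid {m q : ℕ} (i : Fin m → Fin q) : Setoid (Fin m) where
  r j l := ∀ u v, i u = i v → ((u ≤ j ↔ u ≤ l) ↔ (v ≤ j ↔ v ≤ l))
  iseqv := by
    refine ⟨fun j u v _ => by simp, fun {j l} h u v e => ?_, fun {j k l} h1 h2 u v e => ?_⟩
    · have := h u v e; tauto
    · have := h1 u v e; have := h2 u v e; tauto

lemma krew_iff {m q : ℕ} (i : Fin m → Fin q)
    (hnc : Noncrossing (kernelPartition i))
    (κ : Finpartition (univ : Finset (Fin m)))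
    (hκ : IsKreweras (kernelPartition i) κ) (j l : Fin m) :
    SameBlock κ j l ↔ krewSetoid i j l := by
  classical
  constructor
  · -- a partition compatible with the kernel has no separated pairs
    have main : ∀ j l : Fin m, j < l → SameBlock κ j l → ∀ u v, i u = i v →
        j < u → u ≤ l → j < v ∧ v ≤ l := by
      intro j l hjl h u v e h1 h2
      by_contra hcon
      have hh := hκ.1
      rcases lt_or_ge j v with hv | hv
      · have hv2 : l < v := by
          by_contra hx; exact hcon ⟨hv, not_lt.1 hx⟩
        have := hh (j, true) (u, false) (l, true) (v, false)
          (by simp [interPos]; omega) (by simp [interPos]; omega) (by simp [interPos]; omega)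
          ⟨rfl, by simpa using h⟩ ⟨rfl, by simpa [sameBlock_kernel] using e⟩
        simp [UnionRel] at this
      · have := hh (v, false) (j, true) (u, false) (l, true)
          (by simp [interPos]; omega) (by simp [interPos]; omega) (by simp [interPos]; omega)
          ⟨rfl, by simpa [sameBlock_kernel] using e.symm⟩ ⟨rfl, by simpa using h⟩
        simp [UnionRel] at this
    have main2 : ∀ j l : Fin m, j < l → SameBlock κ j l → krewSetoid i j l := by
      intro j l hjl h u v e
      have a1 := main j l hjl h u v e
      have a2 := main j l hjl h v u e.symm
      omega
    intro h
    rcases lt_trichotomy j l with hl | rfl | hl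
    · exact main2 j l hl h
    · exact (krewSetoid i).refl _
    · exact (krewSetoid i).symm (main2 l j hl ((sameBlock_iff _ _ _).2 ((sameBlock_iff _ _ _).1 h).symm))
  · intro h
    have hle := hκ.2 (Finpartition.ofSetoid (krewSetoid i)) (by
      rintro ⟨a, _ | _⟩ ⟨b, _ | _⟩ ⟨c, _ | _⟩ ⟨d, _ | _⟩ h1 h2 h3 ⟨h4, h4'⟩ ⟨h5, h5'⟩
      all_goals first
        | (exfalso; simp at h4; done)
        | (exfalso; simp at h5; done)
        | skip
      all_goals simp [interPos] at h1 h2 h3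
      · simp at h4' h5'
        exact ⟨rfl, by simpa using hnc a b c d (by omega) (by omega) (by omega) h4' h5'⟩
      · exfalso
        simp [sameBlock_ofSetoid, sameBlock_kernel] at h4' h5'
        have := h5' a c h4'
        omega
      · exfalso
        simp [sameBlock_ofSetoid, sameBlock_kernel] at h4' h5'
        have := h4' b d h5'
        omega
      · simp [sameBlock_ofSetoid] at h4' h5'
        refine ⟨rfl, ?_⟩
        simp [sameBlock_ofSetoid]
        intro u v e
        have a1 := h4' u v e
        have a2 := h5' u v e
        omega)
    obtain ⟨B, hB, hj, hl⟩ := (sameBlock_ofSetoid (krewSetoid i) j l).2 h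
    obtain ⟨C, hC, hBC⟩ := hle hB
    exact ⟨C, hC, hBC hj, hBC hl⟩

lemma krew_card {n q : ℕ} (i : Fin (n + 1) → Fin q)
    (hnc : Noncrossing (kernelPartition i))
    (κ : Finpartition (univ : Finset (Fin (n + 1))))
    (hκ : IsKreweras (kernelPartition i) κ) :
    κ.parts.card + (kernelPartition i).parts.card = n + 2 := by
  classical
  rw [card_parts_max, card_parts_min]
  simp only [krew_iff i hnc κ hκ, sameBlock_kernel]
  have key : ∀ k : Fin n, (∀ l, krewSetoid i k.castSucc l → l ≤ k.castSucc) ↔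
      ¬ (∀ l, i k.succ = i l → k.succ ≤ l) := by
    intro k
    constructor
    · intro h hmin
      obtain ⟨l, hl, hlmax⟩ : ∃ l, i k.succ = i l ∧ ∀ w, i k.succ = i w → w ≤ l := by
        have hne : (univ.filter fun w => i k.succ = i w).Nonempty := ⟨k.succ, by simp⟩
        refine ⟨Finset.max' _ hne, ?_, fun w hw => Finset.le_max' _ w (by simpa using hw)⟩
        simpa using Finset.max'_mem _ hne
      have hkl : k.succ ≤ l := hmin l hl
      have main : ∀ u v, i u = i v → k.castSucc < u → u ≤ l → k.castSucc < v ∧ v ≤ l := by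
        intro u v e h1 h2
        have hsu : k.succ ≤ u := by simpa [Fin.lt_def, Fin.le_def, Nat.succ_le_iff] using h1
        by_cases hu : i k.succ = i u
        · have := hmin v (hu.trans e)
          have := hlmax v (hu.trans e)
          simp only [Fin.lt_def, Fin.le_def, Fin.val_succ, Fin.val_castSucc] at *
          omega
        · have n1 : k.succ ≠ u := by rintro rfl; exact hu rfl
          have n2 : u ≠ l := by rintro rfl; exact hu hl
          have l1 : k.succ < u := lt_of_le_of_ne hsu n1
          have l2 : u < l := lt_of_le_of_ne h2 n2
          by_contra hcon
          rcases lt_or_ge k.castSucc v with hv | hv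
          · have hv2 : l < v := by
              by_contra hx; exact hcon ⟨hv, not_lt.1 hx⟩
            have := hnc k.succ u l v l1 l2 hv2 ((sameBlock_kernel _ _ _).2 hl)
              ((sameBlock_kernel _ _ _).2 e)
            exact hu ((sameBlock_kernel _ _ _).1 this)
          · have hv2 : v < k.succ := by
              simp only [Fin.lt_def, Fin.le_def, Fin.val_succ, Fin.val_castSucc] at *
              omega
            have := hnc v k.succ u l hv2 l1 l2 ((sameBlock_kernel _ _ _).2 e.symm)
              ((sameBlock_kernel _ _ _).2 hl)
            exact hu (((sameBlock_kernel _ _ _).1 this).symm.trans e.symm)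
      have hlt : k.castSucc < l := by
        simp only [Fin.lt_def, Fin.le_def, Fin.val_succ, Fin.val_castSucc] at *
        omega
      have := h l (by
        intro u v e
        have a1 := main u v e
        have a2 := main v u e.symm
        simp only [Fin.lt_def, Fin.le_def] at *
        omega)
      exact absurd this (not_le.2 hlt)
    · intro h l hl
      push Not at h
      obtain ⟨p, hp, hlt⟩ := h
      have := hl k.succ p hp
      simp only [Fin.lt_def, Fin.le_def, Fin.val_succ, Fin.val_castSucc] at *
      omega
  rw [Finset.card_filter, Finset.card_filter, Fin.sum_univ_castSucc, Fin.sum_univ_succ (n := n)]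
  rw [if_pos (fun l _ => Fin.le_last l), if_pos (fun l _ => Fin.zero_le l)]
  have : ∑ k : Fin n, ((if ∀ l, krewSetoid i k.castSucc l → l ≤ k.castSucc then 1 else 0) +
      (if ∀ l, i k.succ = i l → k.succ ≤ l then 1 else 0)) = n := by
    rw [Finset.sum_congr rfl (g := fun _ => 1)]
    · simp
    · intro k _
      have := key k
      by_cases h : ∀ l, i k.succ = i l → k.succ ≤ l
      · rw [if_neg (fun h' => (this.1 h') h), if_pos h]
      · rw [if_pos (this.2 h), if_neg h]
  rw [Finset.sum_add_distrib] at this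
  omega

end Kreweras

lemma cyclicProd_eq {n q : ℕ} (i : Fin (n + 1) → Fin q) :
    cyclicProd i = pathProd (List.ofFn i ++ [i 0]) := by
  unfold cyclicProd pathProd
  congr 1
  apply List.ext_getElem
  · simp
  · intro k h1 h2
    simp at h1
    simp only [List.getElem_map, List.getElem_finRange, List.getElem_zipWith, List.getElem_tail,
      Fin.cast_mk]
    congr 1
    · rw [List.getElem_append_left (by simp; omega), List.getElem_ofFn]
    · by_cases hk : k < n
      · rw [List.getElem_append_left (by simp; omega)]
        rw [finRotate_of_lt hk, List.getElem_ofFn]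
      · obtain rfl : k = n := by omega
        rw [List.getElem_append_right (by simp)]
        rw [finRotate_last']
        simp

lemma chain_closed {n q : ℕ} (i : Fin (n + 1) → Fin q)
    (hadj : ∀ j, i j ≠ i (finRotate (n + 1) j)) :
    (List.ofFn i ++ [i 0]).IsChain (· ≠ ·) := by
  rw [List.isChain_iff_getElem]
  intro k h1
  simp at h1
  have := hadj ⟨k, by omega⟩
  rw [List.getElem_append_left (by simp; omega), List.getElem_ofFn]
  by_cases hk : k < n
  · rw [List.getElem_append_left (by simp; omega)]
    rw [finRotate_of_lt hk] at this
    rw [List.getElem_ofFn]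
    exact this
  · obtain rfl : k = n := by omega
    rw [List.getElem_append_right (by simp)]
    rw [finRotate_last'] at this
    simpa using this

lemma nc_list {n q : ℕ} (i : Fin n → Fin q) (hnc : Noncrossing (kernelPartition i)) :
    NCList (List.ofFn i) := by
  intro a b hab hs
  obtain ⟨f, hf⟩ := List.sublist_iff_exists_fin_orderEmbedding_get_eq.1 hs
  have c : ∀ k : Fin 4, (f k).1 < n := fun k => by simpa using (f k).2
  have e0 := hf 0
  have e1 := hf 1
  have e2 := hf 2
  have e3 := hf 3
  simp at e0 e1 e2 e3
  have l1 : f 0 < f 1 := f.strictMono (by simp [Fin.lt_def])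
  have l2 : f 1 < f 2 := f.strictMono (by simp [Fin.lt_def])
  have l3 : f 2 < f 3 := f.strictMono (by simp [Fin.lt_def])
  have := hnc ⟨f 0, c 0⟩ ⟨f 1, c 1⟩ ⟨f 2, c 2⟩ ⟨f 3, c 3⟩ l1 l2 l3
    ((sameBlock_kernel _ _ _).2 (e0.symm.trans e2))
    ((sameBlock_kernel _ _ _).2 (e1.symm.trans e3))
  exact hab (e0.trans (((sameBlock_kernel _ _ _).1 this).trans e1.symm))

lemma nc_closed {α : Type*} (v : α) (t : List α) (h : NCList (v :: t)) :
    NCList (v :: t ++ [v]) := by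
  intro a b hab hs
  rw [List.sublist_append_iff] at hs
  obtain ⟨l1, l2, e, h1, h2⟩ := hs
  rcases List.sublist_singleton.1 h2 with rfl | rfl
  · exact h a b hab (by simpa [e] using h1)
  · have e' : [a, b, a] ++ [b] = l1 ++ [v] := e
    obtain ⟨rfl, e2⟩ := List.append_inj' e' rfl
    simp at e2
    subst e2
    apply h b a hab.symm
    have : List.Sublist [a, b, a] t := by
      cases h1 with
      | cons _ h => exact h
      | cons_cons _ h => exact absurd rfl hab
    exact this.cons_cons b

lemma card_kernel {m q : ℕ} (i : Fin m → Fin q) :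
    (kernelPartition i).parts.card = (List.ofFn i).toFinset.card := by
  have hT : (List.ofFn i).toFinset = univ.image i := by
    ext x; simp
  rw [hT]
  have hiff : ∀ x y, i x = i y ↔ (kernelPartition i).part x = (kernelPartition i).part y := by
    intro x y
    rw [← sameBlock_kernel, sameBlock_iff]
  have hch : ∀ B (hB : B ∈ (kernelPartition i).parts),
      (kernelPartition i).part ((kernelPartition i).nonempty_of_mem_parts hB).choose = B :=
    fun B hB => (kernelPartition i).part_eq_of_mem hB
      ((kernelPartition i).nonempty_of_mem_parts hB).choose_spec
  refine Finset.card_bij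
    (fun B hB => i ((kernelPartition i).nonempty_of_mem_parts hB).choose) ?_ ?_ ?_
  · intro B hB; simp
  · intro B hB C hC h
    rw [hiff, hch B hB, hch C hC] at h
    exact h
  · intro c hc
    obtain ⟨x, -, rfl⟩ := Finset.mem_image.1 hc
    refine ⟨(kernelPartition i).part x, (kernelPartition i).part_mem.2 (mem_univ _), ?_⟩
    rw [hiff, hch _ ((kernelPartition i).part_mem.2 (mem_univ _))]

/-- For a cyclic sequence `(i₁,…,i_m)` in `{1,…,q}` with cyclically
adjacent entries distinct and noncrossing kernel partition `π`, the Cayley length of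
`σ = (i₁,i₂)(i₂,i₃)⋯(i_m,i₁)` equals `m − 2|K(π)|` where `|K(π)| = m + 1 − |π|`;
equivalently `|σ| = 2|π| − m − 2`. -/
theorem stmt14 (m q : ℕ) (hm : 0 < m) (i : Fin m → Fin q)
    (hadj : ∀ j : Fin m, i j ≠ i (finRotate m j))
    (hnc : Noncrossing (kernelPartition i))
    (κ : Finpartition (univ : Finset (Fin m)))
    (hκ : IsKreweras (kernelPartition i) κ) :
    (κ.parts.card : ℤ) = m + 1 - (kernelPartition i).parts.card ∧
    (cayleyLength (cyclicProd i) : ℤ) = m - 2 * κ.parts.card ∧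
    (cayleyLength (cyclicProd i) : ℤ) = 2 * (kernelPartition i).parts.card - m - 2 := by
  obtain ⟨n, rfl⟩ : ∃ n, m = n + 1 := ⟨m - 1, by omega⟩
  have h1 := krew_card i hnc κ hκ
  have hof : List.ofFn i = i 0 :: List.ofFn (fun k : Fin n => i k.succ) := List.ofFn_succ
  have h2 := cl_path _ (List.ofFn i ++ [i 0]) rfl (by simp) (by rw [List.getLast?_concat, hof]; simp)
    (chain_closed i hadj) (by
      have := nc_list i hnc
      rw [hof] at this ⊢
      exact nc_closed _ _ this)
  have hT : (List.ofFn i ++ [i 0]).toFinset = (List.ofFn i).toFinset := by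
    ext x
    rw [hof]
    simp only [List.mem_toFinset, List.mem_append, List.mem_cons, List.not_mem_nil]
    tauto
  rw [hT, ← card_kernel, ← cyclicProd_eq, List.length_append, List.length_ofFn] at h2
  simp only [List.length_singleton] at h2
  push_cast at h2 ⊢
  refine ⟨?_, ?_, ?_⟩ <;> omega
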